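/- arXiv:1208.0931 — 4 statements merged into one kernel-verified Lean document; each statement's English description precedes it below -/
import Mathlib

section
/- Let A be a Noetherian local commutative ring of Krull dimension 1 with maximal ideal 𝔪, and let t ∈ 𝔪 be a non-zero-divisor of A. Then the localization A[t⁻¹] of A away from t is canonically the total quotient ring of A; precisely, A[t⁻¹] (the localization of A at the multiplicative set of powers of t) is a localization of A at the multiplicative set of all non-zero-divisors of A (every non-zero-divisor of A becomes invertible in A[t⁻¹], every element of A[t⁻¹] is a fraction a/s with s a non-zero-divisor, and an element of A maps to 0 in A[t⁻¹] exactly when it is killed by a non-zero-divisor). -/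
/-- In a local ring of dimension at most one, a power of any element of the maximal ideal
is a multiple of any given non-zero-divisor. -/
theorem IsLocalRing.exists_mul_mem_powers_of_mem_nonZeroDivisors {A : Type*} [CommRing A]
    [IsLocalRing A] [Ring.KrullDimLE 1 A] {t s : A} (ht : t ∈ IsLocalRing.maximalIdeal A)
    (hs : s ∈ nonZeroDivisors A) : ∃ m : A, m * s ∈ Submonoid.powers t := by
  have hrad : t ∈ (Ideal.span {s}).radical := by
    rw [Ideal.radical_eq_sInf, Submodule.mem_sInf]
    rintro P ⟨hsP, hP⟩
    rcases Ring.krullDimLE_one_iff.mp inferInstance P hP with hmin | hmax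
    · exact absurd hs <| notMem_nonZeroDivisors_of_mem_mem_minimalPrimes
        (hsP (Ideal.mem_span_singleton_self s)) hmin
    · rwa [IsLocalRing.eq_maximalIdeal hmax]
  obtain ⟨n, hn⟩ := hrad
  obtain ⟨m, hm⟩ := Ideal.mem_span_singleton'.mp hn
  exact ⟨m, n, hm.symm⟩

/-- For a one-dimensional Noetherian local ring `A` and a non-zero-divisor `t` in the
maximal ideal, the localization `A[1/t]` is a localization of `A` at the multiplicative
set of all non-zero-divisors, i.e. it is the total quotient ring of `A`. -/
theorem stmt2 (A : Type*) [CommRing A] [IsNoetherianRing A] [IsLocalRing A]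
    (hdim : ringKrullDim A = 1) (t : A) (ht : t ∈ IsLocalRing.maximalIdeal A)
    (htnzd : t ∈ nonZeroDivisors A) :
    IsLocalization (nonZeroDivisors A) (Localization.Away t) := by
  have : Ring.KrullDimLE 1 A := Ring.krullDimLE_iff.mpr hdim.le
  exact IsLocalization.isLocalization_of_is_exists_mul_mem _ (Submonoid.powers t) _
    (Submonoid.powers_le.mpr htnzd)
    fun s ↦ IsLocalRing.exists_mul_mem_powers_of_mem_nonZeroDivisors ht s.2
end

section
/- Let B be a commutative ring, A ⊆ B a subring which is a local ring with maximal ideal 𝔪, and let J be the Jacobson radical of B (the intersection of all maximal ideals of B). Assume 𝔪 ⊆ J. If f ∈ B satisfies f² ∈ A + J and f³ ∈ A + J, then f ∈ A + J. (Thus the subring A + J of B is seminormally closed in B: it contains every element of B whose square and cube it contains.) -/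
/-- Let `B` be a commutative ring, `A ⊆ B` a subring which is local with maximal ideal
`𝔪`, and `J` the Jacobson radical of `B`; assume `𝔪 ⊆ J`.  If `f ∈ B` has `f² ∈ A + J`
and `f³ ∈ A + J`, then `f ∈ A + J`:  the subring `A + J` is seminormally closed in `B`. -/
theorem stmt5 (B : Type*) [CommRing B] (A : Subring B) [IsLocalRing A]
    (hmJ : ∀ x : A, x ∈ IsLocalRing.maximalIdeal A →
      (x : B) ∈ Ideal.jacobson (⊥ : Ideal B))
    (f : B)
    (h2 : ∃ a ∈ A, f ^ 2 - a ∈ Ideal.jacobson (⊥ : Ideal B))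
    (h3 : ∃ a ∈ A, f ^ 3 - a ∈ Ideal.jacobson (⊥ : Ideal B)) :
    ∃ a ∈ A, f - a ∈ Ideal.jacobson (⊥ : Ideal B) := by
  obtain ⟨a, ha, hfa⟩ := h2
  obtain ⟨b, hb, hfb⟩ := h3
  by_cases hu : IsUnit (⟨a, ha⟩ : A)
  · obtain ⟨u, hu⟩ := hu.exists_right_inv
    have hau : a * (u : B) = 1 := congrArg Subtype.val hu
    refine ⟨b * u, A.mul_mem hb u.2, ?_⟩
    have key : f - b * u = u * ((f ^ 3 - b) - f * (f ^ 2 - a)) := by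
      linear_combination (-f) * hau
    rw [key]
    exact Ideal.mul_mem_left _ _ (sub_mem hfb (Ideal.mul_mem_left _ _ hfa))
  · have hf2 : f ^ 2 ∈ Ideal.jacobson (⊥ : Ideal B) := by
      simpa using add_mem hfa (hmJ ⟨a, ha⟩ ((IsLocalRing.mem_maximalIdeal _).2 hu))
    refine ⟨0, A.zero_mem, ?_⟩
    rw [sub_zero, Ideal.mem_jacobson_bot]
    intro y
    have h := Ideal.mem_jacobson_bot.1 hf2 (-y ^ 2)
    rw [show f ^ 2 * -y ^ 2 + 1 = (f * y + 1) * (1 - f * y) by ring] at h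
    exact isUnit_of_mul_isUnit_left h
end

section
/- Let B be a commutative ring, A ⊆ B a subring which is a local ring with maximal ideal 𝔪, and let J be the Jacobson radical of B (the intersection of all maximal ideals of B). Assume 𝔪 ⊆ J. Then the subring A⁰ := A + J of B is a local ring whose maximal ideal is J (that is, J ⊆ A⁰ is an ideal of A⁰ and every element of A⁰ not in J is invertible in A⁰), and the residue field A⁰/J is isomorphic to A/𝔪. -/
/-- The subring `A + J` of `B`, where `J` is the Jacobson radical of `B`. -/
def subringAddJacobson (B : Type*) [CommRing B] (A : Subring B) : Subring B where
  carrier := {b : B | ∃ a ∈ A, b - a ∈ Ideal.jacobson (⊥ : Ideal B)}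
  one_mem' := ⟨1, A.one_mem, by simp⟩
  zero_mem' := ⟨0, A.zero_mem, by simp⟩
  add_mem' := by
    rintro x y ⟨a, ha, hx⟩ ⟨b, hb, hy⟩
    refine ⟨a + b, A.add_mem ha hb, ?_⟩
    have := Ideal.add_mem _ hx hy
    convert this using 1; ring
  neg_mem' := by
    rintro x ⟨a, ha, hx⟩
    refine ⟨-a, A.neg_mem ha, ?_⟩
    have := (Ideal.jacobson (⊥ : Ideal B)).neg_mem hx
    convert this using 1; ring
  mul_mem' := by
    rintro x y ⟨a, ha, hx⟩ ⟨b, hb, hy⟩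
    refine ⟨a * b, A.mul_mem ha hb, ?_⟩
    have : x * (y - b) + (x - a) * b ∈ Ideal.jacobson (⊥ : Ideal B) :=
      Ideal.add_mem _ (Ideal.mul_mem_left _ _ hy) (Ideal.mul_mem_right _ _ hx)
    convert this using 1; ring

/-- A local subring of `B` whose maximal ideal lies in the Jacobson radical `J` of `B` meets `J`
exactly in its maximal ideal. -/
theorem mem_jacobson_iff_mem_maximalIdeal {B : Type*} [CommRing B] {A : Subring B} [IsLocalRing A]
    (hmJ : ∀ x : A, x ∈ IsLocalRing.maximalIdeal A → (x : B) ∈ Ideal.jacobson (⊥ : Ideal B))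
    (x : A) : (x : B) ∈ Ideal.jacobson (⊥ : Ideal B) ↔ x ∈ IsLocalRing.maximalIdeal A := by
  refine ⟨fun hx => ?_, hmJ x⟩
  have : Nontrivial B := A.subtype_injective.nontrivial
  rw [IsLocalRing.mem_maximalIdeal, mem_nonunits_iff]
  intro hu
  have htop := Ideal.eq_top_of_isUnit_mem _ hx (hu.map A.subtype)
  exact bot_ne_top (Ideal.jacobson_eq_top_iff.mp htop)

/-- An element congruent to a unit modulo the Jacobson radical is a unit. -/
theorem isUnit_of_sub_mem_jacobson_bot {B : Type*} [CommRing B] {u x : B} (hu : IsUnit u)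
    (h : x - u ∈ Ideal.jacobson (⊥ : Ideal B)) : IsUnit x := by
  obtain ⟨v, hv⟩ := hu.exists_right_inv
  have hxv : IsUnit (x * v) := by
    convert Ideal.mem_jacobson_bot.mp h v using 1
    linear_combination hv
  exact isUnit_of_mul_isUnit_left hxv

/-- The inclusion of `A` into `A + J`. -/
def inclusionAddJacobson (B : Type*) [CommRing B] (A : Subring B) :
    A →+* subringAddJacobson B A :=
  Subring.inclusion fun a ha => ⟨a, ha, by simp⟩

/-- Every element of `A + J` outside `J` is invertible in `A + J`. -/
theorem isUnit_of_notMem_jacobson {B : Type*} [CommRing B] {A : Subring B} [IsLocalRing A]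
    (hmJ : ∀ x : A, x ∈ IsLocalRing.maximalIdeal A → (x : B) ∈ Ideal.jacobson (⊥ : Ideal B))
    (x : subringAddJacobson B A) (hx : (x : B) ∉ Ideal.jacobson (⊥ : Ideal B)) : IsUnit x := by
  obtain ⟨x, a, ha, hxa⟩ := x
  have hua : IsUnit (⟨a, ha⟩ : A) := by
    by_contra hn
    have haJ := hmJ ⟨a, ha⟩ ((IsLocalRing.mem_maximalIdeal _).mpr hn)
    exact hx (by simpa using Ideal.add_mem _ hxa haJ)
  obtain ⟨y, hxy⟩ :=
    (isUnit_of_sub_mem_jacobson_bot (hua.map A.subtype) hxa).exists_right_inv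
  obtain ⟨⟨c, hc⟩, hac⟩ := hua.exists_right_inv
  replace hac : a * c = 1 := congrArg Subtype.val hac
  have hy : y ∈ subringAddJacobson B A := by
    refine ⟨c, hc, ?_⟩
    convert Ideal.mul_mem_left _ (-(c * y)) hxa using 1
    linear_combination c * hxy - y * hac
  exact .of_mul_eq_one ⟨y, hy⟩ (Subtype.ext hxy)

/-- The composite `A → A + J → (A + J) / J` is surjective. -/
theorem mk_comp_inclusionAddJacobson_surjective (B : Type*) [CommRing B] (A : Subring B) :
    Function.Surjective ((Ideal.Quotient.mk (Ideal.comap (subringAddJacobson B A).subtype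
      (Ideal.jacobson (⊥ : Ideal B)))).comp (inclusionAddJacobson B A)) := by
  intro q
  obtain ⟨⟨x, a, ha, hxa⟩, rfl⟩ := Ideal.Quotient.mk_surjective q
  refine ⟨⟨a, ha⟩, ?_⟩
  rw [RingHom.comp_apply, eq_comm, Ideal.Quotient.eq]
  exact hxa

/-- The kernel of `A → (A + J) / J` is the maximal ideal of `A`. -/
theorem ker_mk_comp_inclusionAddJacobson {B : Type*} [CommRing B] {A : Subring B} [IsLocalRing A]
    (hmJ : ∀ x : A, x ∈ IsLocalRing.maximalIdeal A → (x : B) ∈ Ideal.jacobson (⊥ : Ideal B)) :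
    RingHom.ker ((Ideal.Quotient.mk (Ideal.comap (subringAddJacobson B A).subtype
      (Ideal.jacobson (⊥ : Ideal B)))).comp (inclusionAddJacobson B A)) =
      IsLocalRing.maximalIdeal A := by
  ext x
  rw [RingHom.mem_ker, RingHom.comp_apply, Ideal.Quotient.eq_zero_iff_mem]
  exact mem_jacobson_iff_mem_maximalIdeal hmJ x

/-- Let `B` be a commutative ring, `A ⊆ B` a local subring with maximal ideal `𝔪 ⊆ J`,
`J` the Jacobson radical of `B`.  Then `A⁰ = A + J` is a local ring with maximal ideal
`J`: `J` is a (proper) ideal of `A⁰`, every element of `A⁰` not in `J` is invertible in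
`A⁰`, and the residue field `A⁰/J` is isomorphic to `A/𝔪`. -/
theorem stmt6 (B : Type*) [CommRing B] (A : Subring B) [IsLocalRing A]
    (hmJ : ∀ x : A, x ∈ IsLocalRing.maximalIdeal A →
      (x : B) ∈ Ideal.jacobson (⊥ : Ideal B)) :
    (∀ b ∈ Ideal.jacobson (⊥ : Ideal B), b ∈ subringAddJacobson B A) ∧
    (Ideal.comap (subringAddJacobson B A).subtype (Ideal.jacobson (⊥ : Ideal B)) ≠ ⊤) ∧
    (∀ x : subringAddJacobson B A,
      x ∉ Ideal.comap (subringAddJacobson B A).subtype (Ideal.jacobson (⊥ : Ideal B)) →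
        IsUnit x) ∧
    Nonempty
      ((subringAddJacobson B A ⧸
          Ideal.comap (subringAddJacobson B A).subtype (Ideal.jacobson (⊥ : Ideal B))) ≃+*
        IsLocalRing.ResidueField A) := by
  have : Nontrivial B := A.subtype_injective.nontrivial
  refine ⟨fun b hb => ⟨0, A.zero_mem, by simpa using hb⟩, ?_,
    fun x hx => isUnit_of_notMem_jacobson hmJ x hx, ⟨?_⟩⟩
  · exact Ideal.comap_ne_top _ fun h => bot_ne_top (Ideal.jacobson_eq_top_iff.mp h)
  · exact (RingHom.quotientKerEquivOfSurjective
      (mk_comp_inclusionAddJacobson_surjective B A)).symm.trans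
      (Ideal.quotEquivOfEq (ker_mk_comp_inclusionAddJacobson hmJ))
end

section
/- Let R be a commutative ring, I an ideal of R, and p a prime number whose image in R lies in I. Then for all x ∈ I and r ≥ 1, (1 + x)^{p^{r-1}} ∈ 1 + I^r; that is, there exists z ∈ I^r with (1 + x)^{p^{r-1}} = 1 + z. (In particular, for a local ring A with maximal ideal 𝔪 of residue characteristic p, for every r ≥ 1 one has (1 + 𝔪)^{p^s} ⊆ 1 + 𝔪^r for all sufficiently large s.) -/
/-- If `I` contains the prime `p`, raising to the `p`-th power maps `1 + I ^ r` into
`1 + I ^ (r + 1)` for `r ≥ 1`. -/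
theorem Ideal.exists_one_add_pow_prime_eq {R : Type*} [CommRing R] {I : Ideal R} {p : ℕ}
    (hp : p.Prime) (hpI : (p : R) ∈ I) {r : ℕ} (hr : 1 ≤ r) {z : R} (hz : z ∈ I ^ r) :
    ∃ w ∈ I ^ (r + 1), (1 + z) ^ p = 1 + w := by
  obtain ⟨c, hc⟩ := exists_add_pow_prime_eq hp 1 z
  refine ⟨z ^ p + p * z * c, add_mem ?_ (Ideal.mul_mem_right _ _ ?_), ?_⟩
  · have hle : r + 1 ≤ r * p := by nlinarith [hp.two_le]
    refine Ideal.pow_le_pow_right hle ?_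
    rw [pow_mul]
    exact Ideal.pow_mem_pow hz p
  · rw [pow_succ']
    exact Ideal.mul_mem_mul hpI hz
  · rw [hc]
    ring

/-- If `I` is an ideal of a commutative ring `R` containing (the image of) a prime `p`,
then for `x ∈ I` and `r ≥ 1` one has `(1 + x)^(p^(r-1)) ∈ 1 + I^r`. -/
theorem stmt11 (R : Type*) [CommRing R] (I : Ideal R) (p : ℕ) (hp : p.Prime)
    (hpI : (p : R) ∈ I) (x : R) (hx : x ∈ I) (r : ℕ) (hr : 1 ≤ r) :
    ∃ z ∈ I ^ r, (1 + x) ^ p ^ (r - 1) = 1 + z := by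
  induction r, hr using Nat.le_induction with
  | base => exact ⟨x, by simpa using hx, by simp⟩
  | succ r hr ih =>
    obtain ⟨z, hz, h⟩ := ih
    obtain ⟨w, hw, h'⟩ := Ideal.exists_one_add_pow_prime_eq hp hpI hr hz
    refine ⟨w, hw, ?_⟩
    rw [← h', ← h, ← pow_mul, ← pow_succ, Nat.sub_add_cancel hr, Nat.add_sub_cancel]
end
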